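/- Let Δ > 0 and K be a natural number with r_γ = K·Δ, and let e : ℝ → ℝ be a map whose values all lie on the lattice {k·Δ : k ∈ ℤ} (for example the floor map e(x) = Δ·⌊x/Δ⌋ or the ceiling map e(x) = Δ·⌈x/Δ⌉). Let Z_Δ := {k·Δ : k ∈ ℤ, |k·Δ| ≤ r_γ}. Suppose v̂ : S × ℝ → ℝ is bounded and satisfies T^e v̂(s,z) = v̂(s,z) for every s ∈ S and every z ∈ Z_Δ. Then the function v defined by v(s,z) := T^e v̂(s,z) satisfies T^e v = v on all of S × ℝ; hence v equals the unique bounded fixed point of T^e. -/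

import Mathlib

/-- The clamp `p(x) = max (−c) (min x c)`. -/
noncomputable def clampP (c : ℝ) (x : ℝ) : ℝ := max (-c) (min x c)

/-- The bounding operator `T^e`:
`T^e v (s, z) = max_{a ∈ A} [min 0 (r s a + z) - min 0 z
  + γ * Σ_{s'} P(s'|s,a) * v (s', p (e ((r s a + z) / γ)))]`,
where `p` is the clamp to `[-rγ, rγ]`. `T^p` is the case `e = id`. -/
noncomputable def Te {S A : Type*} [Fintype S] [Fintype A] [Nonempty A]
    (P : S → A → PMF S) (r : S → A → ℝ) (γ rγ : ℝ) (e : ℝ → ℝ)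
    (v : S × ℝ → ℝ) : S × ℝ → ℝ :=
  fun x => Finset.univ.sup' Finset.univ_nonempty fun a =>
    min 0 (r x.1 a + x.2) - min 0 x.2
      + γ * ∑ s' : S, ((P x.1 a) s').toReal *
          v (s', clampP rγ (e ((r x.1 a + x.2) / γ)))


open Filter Topology in
/-- A nonnegative-factor geometric self-improvement forces a bounded quantity to vanish. -/
theorem eq_of_abs_sub_le_mul {X : Type*} {γ : ℝ} (h0 : 0 ≤ γ) (h1 : γ < 1) {u v : X → ℝ} {C : ℝ}
    (hC : ∀ x, |u x - v x| ≤ C)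
    (step : ∀ D : ℝ, (∀ x, |u x - v x| ≤ D) → ∀ x, |u x - v x| ≤ γ * D) : u = v := by
  have key : ∀ n : ℕ, ∀ x, |u x - v x| ≤ γ ^ n * C := by
    intro n
    induction n with
    | zero => simpa using hC
    | succ n ih =>
      intro x
      have := step _ ih x
      rwa [← mul_assoc, ← pow_succ'] at this
  funext x
  have hlim : Tendsto (fun n : ℕ => γ ^ n * C) atTop (𝓝 0) := by
    simpa using (tendsto_pow_atTop_nhds_zero_of_lt_one h0 h1).mul_const C
  have hle : |u x - v x| ≤ 0 := ge_of_tendsto' hlim fun n => key n x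
  exact sub_eq_zero.mp (abs_nonpos_iff.mp hle)

theorem abs_clampP_le {c : ℝ} (hc : 0 ≤ c) (x : ℝ) : |clampP c x| ≤ c :=
  abs_le.mpr ⟨le_max_left _ _, max_le (by linarith) (min_le_right _ _)⟩

/-- Clamping at a lattice point preserves the lattice. -/
theorem exists_int_clampP_eq (Δ : ℝ) (K : ℕ) (k : ℤ) :
    ∃ j : ℤ, clampP ((K : ℝ) * Δ) ((k : ℝ) * Δ) = (j : ℝ) * Δ := by
  unfold clampP
  rcases max_choice (-((K : ℝ) * Δ)) (min ((k : ℝ) * Δ) ((K : ℝ) * Δ)) with h | h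
  · exact ⟨-K, by rw [h]; push_cast; ring⟩
  · rcases min_choice ((k : ℝ) * Δ) ((K : ℝ) * Δ) with h' | h'
    · exact ⟨k, by rw [h, h']⟩
    · exact ⟨K, by rw [h, h']; push_cast; ring⟩

theorem PMF.sum_toReal_eq_one {S : Type*} [Fintype S] (p : PMF S) :
    ∑ s, (p s).toReal = 1 := by
  rw [← ENNReal.toReal_sum fun s _ => p.apply_ne_top s, ← tsum_fintype (L := .unconditional S),
    p.tsum_coe, ENNReal.toReal_one]

section Te

variable {S A : Type*} [Fintype S] [Fintype A] [Nonempty A]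
  (P : S → A → PMF S) (r : S → A → ℝ) {γ : ℝ} (rγ : ℝ) (e : ℝ → ℝ)

theorem Te_le_add (hγ : 0 ≤ γ) {u v : S × ℝ → ℝ} {C : ℝ} (h : ∀ x, u x ≤ v x + C)
    (x : S × ℝ) : Te P r γ rγ e u x ≤ Te P r γ rγ e v x + γ * C := by
  refine Finset.sup'_le _ _ fun a _ => ?_
  have hv := Finset.le_sup' (fun a => min 0 (r x.1 a + x.2) - min 0 x.2
    + γ * ∑ s' : S, ((P x.1 a) s').toReal *
        v (s', clampP rγ (e ((r x.1 a + x.2) / γ)))) (Finset.mem_univ a)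
  have hsum : ∑ s' : S, ((P x.1 a) s').toReal * u (s', clampP rγ (e ((r x.1 a + x.2) / γ)))
      ≤ ∑ s' : S, ((P x.1 a) s').toReal * v (s', clampP rγ (e ((r x.1 a + x.2) / γ))) + C := by
    calc _ ≤ ∑ s' : S, ((P x.1 a) s').toReal *
            (v (s', clampP rγ (e ((r x.1 a + x.2) / γ))) + C) :=
          Finset.sum_le_sum fun s' _ => mul_le_mul_of_nonneg_left (h _) ENNReal.toReal_nonneg
      _ = _ := by
          simp only [mul_add, Finset.sum_add_distrib, ← Finset.sum_mul,
            PMF.sum_toReal_eq_one, one_mul]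
  have hmul := mul_le_mul_of_nonneg_left hsum hγ
  unfold Te
  linarith

/-- `T^e` is a `γ`-contraction in sup-norm. -/
theorem abs_Te_sub_Te_le (hγ : 0 ≤ γ) {u v : S × ℝ → ℝ} {C : ℝ} (h : ∀ x, |u x - v x| ≤ C)
    (x : S × ℝ) : |Te P r γ rγ e u x - Te P r γ rγ e v x| ≤ γ * C := by
  have huv := Te_le_add P r rγ e hγ (u := u) (v := v) (C := C)
    (fun y => by linarith [(abs_le.mp (h y)).2]) x
  have hvu := Te_le_add P r rγ e hγ (u := v) (v := u) (C := C)
    (fun y => by linarith [(abs_le.mp (h y)).1]) x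
  exact abs_le.mpr ⟨by linarith, by linarith⟩

/-- `T^e v` depends only on the values of `v` at clamped points of the range of `e`. -/
theorem Te_congr {u v : S × ℝ → ℝ}
    (h : ∀ s y, u (s, clampP rγ (e y)) = v (s, clampP rγ (e y))) :
    Te P r γ rγ e u = Te P r γ rγ e v := by
  unfold Te
  simp only [h]

end Te

/-- if `e` takes values on the lattice `{k·Δ : k ∈ ℤ}`, `r_γ = K·Δ`, and the
bounded function `v̂` satisfies `T^e v̂ = v̂` on the finite grid
`Z_Δ = {k·Δ : k ∈ ℤ, |k·Δ| ≤ r_γ}`, then `v := T^e v̂` is a fixed point of `T^e` on all of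
`S × ℝ`; hence `v` is the unique bounded fixed point of `T^e`. -/
theorem Te_fixedPoint_from_grid
    {S A : Type*} [Fintype S] [Nonempty S] [Fintype A] [Nonempty A]
    (P : S → A → PMF S) (r : S → A → ℝ) (r_max : ℝ) (hr_max : 0 < r_max)
    (hr : ∀ s a, |r s a| ≤ r_max) (γ : ℝ) (hγ : γ ∈ Set.Ioo (0 : ℝ) 1)
    (Δ : ℝ) (hΔ : 0 < Δ) (K : ℕ) (hK : r_max / (1 - γ) = (K : ℝ) * Δ)
    (e : ℝ → ℝ) (he : ∀ x : ℝ, ∃ k : ℤ, e x = (k : ℝ) * Δ)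
    (vhat : S × ℝ → ℝ) (hb : ∃ M : ℝ, ∀ s z, |vhat (s, z)| ≤ M)
    (hgrid : ∀ (s : S) (z : ℝ), (∃ k : ℤ, z = (k : ℝ) * Δ ∧ |z| ≤ r_max / (1 - γ)) →
      Te P r γ (r_max / (1 - γ)) e vhat (s, z) = vhat (s, z)) :
    Te P r γ (r_max / (1 - γ)) e (Te P r γ (r_max / (1 - γ)) e vhat)
        = Te P r γ (r_max / (1 - γ)) e vhat ∧
    ∀ w : S × ℝ → ℝ, (∃ M : ℝ, ∀ s z, |w (s, z)| ≤ M) →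
      Te P r γ (r_max / (1 - γ)) e w = w → w = Te P r γ (r_max / (1 - γ)) e vhat := by
  obtain ⟨hγ0, hγ1⟩ := hγ
  have hc : 0 ≤ r_max / (1 - γ) := div_nonneg hr_max.le (by linarith)
  have hfix : Te P r γ (r_max / (1 - γ)) e (Te P r γ (r_max / (1 - γ)) e vhat)
      = Te P r γ (r_max / (1 - γ)) e vhat := by
    refine Te_congr P r _ e fun s y => hgrid s _ ?_
    obtain ⟨k, hk⟩ := he y
    obtain ⟨j, hj⟩ := exists_int_clampP_eq Δ K k
    exact ⟨j, by rw [hk, hK, hj], abs_clampP_le hc _⟩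
  refine ⟨hfix, fun w ⟨N, hN⟩ hw => ?_⟩
  obtain ⟨M, hM⟩ := hb
  have hbound : ∀ x, |w x - vhat x| ≤ N + M := fun ⟨s, z⟩ =>
    (abs_sub _ _).trans (add_le_add (hN s z) (hM s z))
  refine eq_of_abs_sub_le_mul hγ0.le hγ1 (C := γ * (N + M)) (fun x => ?_) fun D hD x => ?_
  · simpa only [hw] using abs_Te_sub_Te_le P r (r_max / (1 - γ)) e hγ0.le hbound x
  · simpa only [hw, hfix] using abs_Te_sub_Te_le P r (r_max / (1 - γ)) e hγ0.le hD x
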